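/- Let q = e^{2πi/3}, let n ≥ 1, and let β be a nonzero complex number with β² ≠ 1; set x = −(βq − (βq)^{−1})/(β − β^{−1}) and assume 1 − x + x² ≠ 0. Then for every extension X of the symplectic character ratio of size 2n, one has X(1, …, 1, (β/q)²) = ( 3^{n(n−1)} / (1 − x + x²)^{n−1} ) · det_{i,j=1}^{n−1} ( (x−1)² C(i+j−1, 2j−i) + x · C(i+j+1, 2j−i+1) ), where the first 2n−1 arguments of X equal 1 and the empty determinant (n = 1) equals 1. -/

import Mathlib

noncomputable section

/-- `δ_i = N − i + 1` for the 1-based index `i`; here `i : Fin N` is 0-based. -/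
def deltaE (N : ℕ) (i : Fin N) : ℕ := N - i.1

/-- `μ_i = λ_i + δ_i` with `λ_i = ⌊(N−i)/2⌋` for the 1-based index `i`. -/
def muE (N : ℕ) (i : Fin N) : ℕ := (N - i.1 - 1) / 2 + (N - i.1)

/-- The determinant `det_{i,j} (z_j^{e_i} − z_j^{−e_i})`. -/
def sdet (N : ℕ) (e : Fin N → ℕ) (z : Fin N → ℂ) : ℂ :=
  Matrix.det (Matrix.of fun i j : Fin N => z j ^ (e i : ℤ) - z j ^ (-(e i : ℤ)))

/-- `X` is a (continuous) extension of the symplectic character ratio of size `N`: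
it agrees with `det(z_j^{μ_i} − z_j^{−μ_i}) / det(z_j^{δ_i} − z_j^{−δ_i})`
whenever the denominator is nonzero. -/
def IsSymplecticExt (N : ℕ) (X : (Fin N → ℂ) → ℂ) : Prop :=
  ContinuousOn X {z : Fin N → ℂ | ∀ i, z i ≠ 0} ∧
  ∀ z : Fin N → ℂ, (∀ i, z i ≠ 0) → sdet N (deltaE N) z ≠ 0 →
    X z = sdet N (muE N) z / sdet N (deltaE N) z

/-- Binomial coefficient `C(a,b)` for integers, vanishing unless `0 ≤ b ≤ a`. -/
def zchoose (a b : ℤ) : ℤ := if 0 ≤ b ∧ b ≤ a then (a.toNat).choose b.toNat else 0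

section

open Matrix Polynomial Finset

theorem det_eq_prod_mul_det_of_sub_mem_span {α : Type*} {N : ℕ} (f h : ℕ → α → ℂ) (a : ℕ → ℂ)
    (x : Fin N → α)
    (H : ∀ k < N, f k - a k • h k ∈ Submodule.span ℂ (h '' Set.Iio k)) :
    (Matrix.of fun i j : Fin N => f i (x j)).det =
      (∏ i : Fin N, a i) * (Matrix.of fun i j : Fin N => h i (x j)).det := by
  have H' : ∀ k, ∃ c : ℕ → ℂ, k < N →
      f k = a k • h k + ∑ l ∈ Finset.range k, c l • h l := by
    intro k
    by_cases hk : k < N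
    · have := H k hk
      rw [← Finset.coe_range, Submodule.mem_span_image_finset_iff_exists_fun'] at this
      obtain ⟨c, hc⟩ := this
      exact ⟨c, fun _ => by rw [hc]; abel⟩
    · exact ⟨0, fun h => absurd h hk⟩
  choose c hc using H'
  let T : Matrix (Fin N) (Fin N) ℂ :=
    Matrix.of fun i l => if l < i then c i l else if l = i then a i else 0
  have hT : T.det = ∏ i : Fin N, a i := by
    rw [Matrix.det_of_isLowerTriangular]
    · simp [T]
    · intro i j hij
      have hij : i < j := by simpa using hij
      simp [T, hij.not_gt, hij.ne']
  rw [← hT, ← Matrix.det_mul]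
  congr 1
  ext i j
  have e1 : ∀ l : Fin N, T i l * h l (x j) =
      (if l.1 < i.1 then c i l * h l (x j) else 0) + if l = i then a i * h i (x j) else 0 := by
    intro l
    simp only [T, Matrix.of_apply, Fin.lt_def]
    by_cases h1 : l.1 < i.1
    · have : l ≠ i := by rintro rfl; exact lt_irrefl _ h1
      simp [h1, this]
    · by_cases h2 : l = i
      · subst h2; simp
      · simp [h1, h2]
  simp only [Matrix.of_apply, Matrix.mul_apply, e1]
  rw [Finset.sum_add_distrib, hc i i.2,
    Fin.sum_univ_eq_sum_range (fun l => if l < i.1 then c i l * h l (x j) else 0) N,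
    ← Finset.sum_filter]
  have : (Finset.range N).filter (fun l => l < i.1) = Finset.range i.1 := by
    ext l; simp; omega
  rw [this]
  simp [Finset.sum_apply, add_comm]

/-- Coefficients of `x ^ m` in the Newton basis with nodes `τ 0, τ 1, …`. -/
def newtonCoeff (τ : ℕ → ℂ) : ℕ → ℕ → ℂ
  | 0, l => if l = 0 then 1 else 0
  | m + 1, 0 => τ 0 * newtonCoeff τ m 0
  | m + 1, l + 1 => τ (l + 1) * newtonCoeff τ m (l + 1) + newtonCoeff τ m l

theorem sum_newtonCoeff_mul_prod (τ : ℕ → ℂ) (M : ℕ) (x : ℂ)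
    (hx : ∏ r ∈ Finset.range (M + 1), (x - τ r) = 0) (m : ℕ) :
    ∑ l ∈ Finset.range (M + 1), newtonCoeff τ m l * ∏ r ∈ Finset.range l, (x - τ r) = x ^ m := by
  induction m with
  | zero => simp [newtonCoeff]
  | succ m ih =>
    have key : ∀ l, newtonCoeff τ m l * (∏ r ∈ Finset.range l, (x - τ r)) * x =
        τ l * newtonCoeff τ m l * (∏ r ∈ Finset.range l, (x - τ r)) +
          newtonCoeff τ m l * ∏ r ∈ Finset.range (l + 1), (x - τ r) := by
      intro l; rw [Finset.prod_range_succ]; ring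
    rw [pow_succ, ← ih, Finset.sum_mul]
    simp only [key]
    rw [Finset.sum_add_distrib, Finset.sum_range_succ (fun l => newtonCoeff τ m l *
      ∏ r ∈ Finset.range (l + 1), (x - τ r)), hx, Finset.sum_range_succ',
      Finset.sum_range_succ']
    simp only [newtonCoeff, add_mul, Finset.sum_add_distrib]
    ring

theorem newtonCoeff_of_forall_eq_zero (τ : ℕ → ℂ) (M : ℕ) (hτ : ∀ r < M, τ r = 0) (m l : ℕ)
    (hl : l < M) : newtonCoeff τ m l = if l = m then 1 else 0 := by
  induction m generalizing l with
  | zero => simp [newtonCoeff]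
  | succ m ih =>
    cases l with
    | zero => simp [newtonCoeff, hτ 0 hl]
    | succ l => simp [newtonCoeff, hτ _ hl, ih l (by omega)]

theorem continuous_newtonCoeff {X : Type*} [TopologicalSpace X] (τ : X → ℕ → ℂ)
    (hτ : ∀ r, Continuous fun y => τ y r) (m l : ℕ) :
    Continuous fun y => newtonCoeff (τ y) m l := by
  induction m generalizing l with
  | zero => simp only [newtonCoeff]; fun_prop
  | succ m ih =>
    cases l with
    | zero => simp only [newtonCoeff]; exact (hτ 0).mul (ih 0)
    | succ l => simp only [newtonCoeff]; exact ((hτ _).mul (ih _)).add (ih l)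

/-- The row of Taylor coefficients of `p` at `0` up to order `M - 1`, followed by the value of `p`
at `t₀`. -/
def jetRow (M : ℕ) (t₀ : ℂ) : ℂ[X] →ₗ[ℂ] ℕ → ℂ where
  toFun p j := if j < M then p.coeff j else p.eval t₀
  map_add' p q := by ext j; simp only [Pi.add_apply]; split_ifs <;> simp
  map_smul' c p := by ext j; simp only [Pi.smul_apply, RingHom.id_apply]; split_ifs <;> simp

theorem exists_continuous_eq_mul_det_vandermonde (M : ℕ) (F : ℕ → ℂ[X]) :
    ∃ Φ : (Fin (M + 1) → ℂ) → ℂ, Continuous Φ ∧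
      (∀ t, (Matrix.of fun i j : Fin (M + 1) => (F i).eval (t j)).det =
        Φ t * (Matrix.vandermonde t).det) ∧
      ∀ t₀, Φ (fun j => if j.1 < M then 0 else t₀) * t₀ ^ M =
        (Matrix.of fun i j : Fin (M + 1) => jetRow M t₀ (F i) j).det := by
  let τ : (Fin (M + 1) → ℂ) → ℕ → ℂ := fun t r => if h : r < M + 1 then t ⟨r, h⟩ else 0
  have hτ : ∀ t (j : Fin (M + 1)), τ t j = t j := fun t j => by
    simp only [τ, dif_pos j.2]
  have hτc : ∀ r, Continuous fun t => τ t r := by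
    intro r
    by_cases h : r < M + 1
    · simp only [τ, h, dif_pos]; fun_prop
    · simp only [τ, h, dif_neg, not_false_eq_true]; fun_prop
  let A : (Fin (M + 1) → ℂ) → Matrix (Fin (M + 1)) (Fin (M + 1)) ℂ := fun t =>
    Matrix.of fun i l => (F i).sum fun m a => a * newtonCoeff (τ t) m l
  have hA : ∀ t x, (∏ r ∈ Finset.range (M + 1), (x - τ t r) = 0) → ∀ i : Fin (M + 1),
      ∑ l : Fin (M + 1), A t i l * ∏ r ∈ Finset.range l, (x - τ t r) = (F i).eval x := by
    intro t x hx i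
    simp only [A, Matrix.of_apply, Polynomial.sum_def, Finset.sum_mul]
    rw [Finset.sum_comm, Polynomial.eval_eq_sum, Polynomial.sum_def]
    refine Finset.sum_congr rfl fun m _ => ?_
    rw [← sum_newtonCoeff_mul_prod (τ t) M x hx m, Finset.mul_sum, ← Fin.sum_univ_eq_sum_range
      (fun l => (F i).coeff m * (newtonCoeff (τ t) m l * ∏ r ∈ Finset.range l, (x - τ t r)))]
    exact Finset.sum_congr rfl fun l _ => by ring
  refine ⟨fun t => (A t).det, ?_, ?_, ?_⟩
  · refine Continuous.matrix_det (continuous_matrix fun i l => ?_)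
    simp only [A, Matrix.of_apply, Polynomial.sum_def]
    exact continuous_finsetSum _ fun m _ => continuous_const.mul (continuous_newtonCoeff _ hτc _ _)
  · intro t
    let W : Matrix (Fin (M + 1)) (Fin (M + 1)) ℂ :=
      Matrix.of fun l j => ∏ r ∈ Finset.range l, (t j - τ t r)
    have hW : W.det = (Matrix.vandermonde t).det := by
      rw [Matrix.det_of_isUpperTriangular, Matrix.det_vandermonde]
      · have : ∀ j : Fin (M + 1), W j j = ∏ i ∈ Finset.Iio j, (t j - t i) := by
          intro j
          simp only [W, Matrix.of_apply]
          symm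
          refine Finset.prod_bij (fun i _ => i.1) ?_ ?_ ?_ ?_
          · intro i hi; simpa using hi
          · intro a _ b _ h; exact Fin.ext h
          · intro b hb
            have hb : b < j.1 := by simpa using hb
            exact ⟨⟨b, by omega⟩, by simpa [Fin.lt_def] using hb, rfl⟩
          · intro i _; rw [hτ]
        simp only [this]
        exact Finset.prod_comm' (by simp)
      · intro l j hlj
        have hlj : j < l := hlj
        simp only [W, Matrix.of_apply]
        exact Finset.prod_eq_zero (i := j.1) (by simpa using hlj) (by simp [hτ])
    rw [← hW, ← Matrix.det_mul]
    congr 1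
    ext i j
    simp only [Matrix.mul_apply, W, Matrix.of_apply]
    exact (hA t (t j) (Finset.prod_eq_zero (i := j.1) (by simp [j.is_le]) (by simp [hτ])) i).symm
  · intro t₀
    set t : Fin (M + 1) → ℂ := fun j => if j.1 < M then 0 else t₀ with ht
    have h0 : ∀ r < M, τ t r = 0 := fun r hr => by
      have : r < M + 1 := by omega
      simp [τ, ht, hr]
    have h1 : τ t M = t₀ := by simp [τ, ht]
    let W : Matrix (Fin (M + 1)) (Fin (M + 1)) ℂ :=
      Matrix.of fun l j => if j.1 < M then if l = j then 1 else 0 else t₀ ^ l.1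
    have hW : W.det = t₀ ^ M := by
      rw [Matrix.det_of_isUpperTriangular]
      · simp [W, Fin.prod_univ_castSucc]
      · intro l j hlj
        have hlj : j < l := hlj
        have : j.1 < M := by have := l.2; have : j.1 < l.1 := hlj; omega
        simp [W, this, hlj.ne']
    rw [← hW, ← Matrix.det_mul]
    congr 1
    ext i j
    simp only [Matrix.mul_apply, W, Matrix.of_apply, jetRow, LinearMap.coe_mk, AddHom.coe_mk]
    by_cases hj : j.1 < M
    · simp only [hj, if_true, mul_ite, mul_one, mul_zero, Finset.sum_ite_eq', Finset.mem_univ,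
        A, Matrix.of_apply]
      simp only [newtonCoeff_of_forall_eq_zero _ M h0 _ _ hj, mul_ite, mul_one, mul_zero,
        Polynomial.sum_def]
      simp +contextual [eq_comm]
    · simp only [hj, if_false]
      rw [← hA t t₀ (Finset.prod_eq_zero (i := M) (by simp) (by simp [h1])) i]
      refine Finset.sum_congr rfl fun l _ => ?_
      congr 1
      rw [Finset.prod_congr rfl (g := fun _ => t₀)]
      · simp
      · intro r hr
        have : r < l.1 := by simpa using hr
        rw [h0 r (by omega), sub_zero]

theorem zchoose_succ_left (N : ℕ) (k : ℤ) :
    zchoose (N + 1) k = zchoose N k + zchoose N (k - 1) := by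
  rcases lt_trichotomy k 0 with hk | rfl | hk
  · simp [zchoose, hk.not_ge, show ¬ (1 ≤ k) by omega]
  · have : (0 : ℤ) ≤ N + 1 := by omega
    simp [zchoose, this]
  · obtain ⟨l, rfl⟩ : ∃ l : ℕ, k = l + 1 := ⟨(k - 1).toNat, by omega⟩
    have h1 : ((N : ℤ) + 1).toNat = N + 1 := by omega
    have h2 : ((l : ℤ) + 1).toNat = l + 1 := by omega
    have h3 : (0 : ℤ) ≤ l + 1 := by omega
    simp only [zchoose, h1, h2, h3, true_and, add_sub_cancel_right, Int.toNat_natCast]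
    rcases lt_trichotomy l N with h | h | h
    · rw [if_pos (by omega), if_pos (by omega), if_pos (by omega), Nat.choose_succ_succ]
      push_cast; ring
    · subst h
      rw [if_pos (by omega), if_neg (by omega), if_pos (by omega)]
      simp
    · rw [if_neg (by omega), if_neg (by omega), if_neg (by omega)]
      simp

theorem zchoose_add_three_left (N : ℕ) (k : ℤ) :
    zchoose (N + 3) k = 3 * zchoose (N + 1) (k - 1) + zchoose N (k - 3) + zchoose N k := by
  have h3 := zchoose_succ_left (N + 2) k
  have h2 := zchoose_succ_left (N + 1) k
  have h2' := zchoose_succ_left (N + 1) (k - 1)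
  have h1 := zchoose_succ_left N k
  have h1' := zchoose_succ_left N (k - 1)
  have h1'' := zchoose_succ_left N (k - 2)
  push_cast at h3 h2 h2'
  rw [show (N : ℤ) + 2 + 1 = N + 3 by ring] at h3
  rw [show (N : ℤ) + 1 + 1 = N + 2 by ring] at h2 h2'
  rw [show k - 1 - 1 = k - 2 by ring] at h2' h1'
  rw [show k - 2 - 1 = k - 3 by ring] at h1''
  linarith

theorem zchoose_of_neg {a b : ℤ} (hb : b < 0) : zchoose a b = 0 := by
  simp [zchoose, hb.not_ge]

theorem zchoose_of_lt {a b : ℤ} (hb : a < b) : zchoose a b = 0 := by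
  simp [zchoose, hb.not_ge]

/-- The signed row generating polynomials `∑ⱼ (-1) ^ (i + j) C(i + j + 1, 2 j - i + 1) X ^ j`,
defined through their three-term recurrence. -/
noncomputable def stairPoly : ℕ → ℂ[X]
  | 0 => 1
  | 1 => -(1 - 3 * X + X ^ 2)
  | i + 2 => (3 * X - X ^ 2) * stairPoly (i + 1) - X * stairPoly i

theorem coeff_stairPoly (i j : ℕ) :
    (stairPoly i).coeff j = (-1) ^ (i + j) * (zchoose (i + j + 1) (2 * j - i + 1) : ℂ) := by
  induction i using Nat.strong_induction_on generalizing j with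
  | _ i ih =>
  match i, ih with
  | 0, _ =>
    cases j with
    | zero => simp [stairPoly, zchoose]
    | succ j =>
      rw [zchoose_of_lt (by push_cast; omega)]
      simp [stairPoly, coeff_one]
  | 1, _ =>
    match j with
    | 0 => simp [stairPoly, zchoose]
    | 1 =>
      simp [stairPoly, zchoose, coeff_one, coeff_X_pow]
    | 2 =>
      simp [stairPoly, zchoose, coeff_one, coeff_X_pow, coeff_X]
      norm_num
    | j + 3 =>
      rw [zchoose_of_lt (by push_cast; omega)]
      simp [stairPoly, coeff_one, coeff_X_pow, coeff_X]
  | i + 2, ih =>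
    have e : stairPoly (i + 2) = 3 * (X * stairPoly (i + 1)) - X * (X * stairPoly (i + 1))
        - X * stairPoly i := by rw [stairPoly]; ring
    rw [e]
    have h3 : ∀ p : ℂ[X], ∀ k, (3 * p).coeff k = 3 * p.coeff k := fun p k => by
      rw [← map_ofNat (C : ℂ →+* ℂ[X]) 3, coeff_C_mul]
    have hX1 : ∀ p : ℂ[X], (X * p).coeff 1 = p.coeff 0 := fun p => coeff_X_mul p 0
    have key := zchoose_add_three_left (i + j) (2 * j - i - 1)
    have key' := congrArg (Int.cast : ℤ → ℂ) key
    push_cast at key'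
    have e1 : ((i + 2 : ℕ) : ℤ) + j + 1 = i + j + 3 := by push_cast; ring
    have e2 : 2 * (j : ℤ) - ((i + 2 : ℕ) : ℤ) + 1 = 2 * j - i - 1 := by push_cast; ring
    rw [e1, e2, key']
    match j with
    | 0 =>
      rw [zchoose_of_neg, zchoose_of_neg, zchoose_of_neg]
      · simp
      all_goals push_cast; omega
    | 1 =>
      rw [zchoose_of_neg (b := 2 * ((1 : ℕ) : ℤ) - i - 1 - 3) (by push_cast; omega)]
      simp only [coeff_sub, h3, hX1, coeff_X_mul_zero, ih (i + 1) (by omega), ih i (by omega)]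
      push_cast
      ring_nf
    | j + 2 =>
      simp only [coeff_sub, h3, coeff_X_mul, ih (i + 1) (by omega), ih i (by omega),
        show j + 2 = j + 1 + 1 from rfl]
      push_cast
      ring_nf

/-- The rows of the linear pencil obtained from `stairPoly` by dividing out `X - t₀`. -/
noncomputable def pencilPoly (t₀ : ℂ) : ℕ → ℂ[X]
  | 0 => 3 - X - C t₀
  | i + 1 => (3 - X - C t₀) * stairPoly (i + 1) - stairPoly i

theorem coeff_pencilPoly (t₀ : ℂ) (i j : ℕ) :
    (pencilPoly t₀ i).coeff j = (-1) ^ (i + j) *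
      ((zchoose (i + j + 3) (2 * j - i + 2) : ℂ) - t₀ * zchoose (i + j + 1) (2 * j - i + 1)) := by
  have key := zchoose_add_three_left (i + j) (2 * j - i + 2)
  have key' := congrArg (Int.cast : ℤ → ℂ) key
  push_cast at key'
  rw [key']
  have h3 : ∀ p : ℂ[X], ∀ k, (3 * p).coeff k = 3 * p.coeff k := fun p k => by
    rw [← map_ofNat (C : ℂ →+* ℂ[X]) 3, coeff_C_mul]
  have hX : ∀ i, (3 - X - C t₀) * stairPoly i =
      3 * stairPoly i - X * stairPoly i - C t₀ * stairPoly i := fun i => by ring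
  cases i with
  | zero =>
    have e : pencilPoly t₀ 0 = (3 - X - C t₀) * stairPoly 0 := by simp [pencilPoly, stairPoly]
    rw [e, hX, zchoose_of_lt (b := 2 * (j : ℤ) - ((0 : ℕ) : ℤ) + 2) (by push_cast; omega)]
    cases j with
    | zero =>
      rw [zchoose_of_neg (b := 2 * ((0 : ℕ) : ℤ) - ((0 : ℕ) : ℤ) + 2 - 3) (by simp)]
      simp only [coeff_sub, h3, coeff_X_mul_zero, coeff_C_mul, coeff_stairPoly]
      push_cast
      ring_nf
    | succ j =>
      simp only [coeff_sub, h3, coeff_X_mul, coeff_C_mul, coeff_stairPoly]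
      push_cast
      ring_nf
  | succ i =>
    rw [pencilPoly, hX]
    cases j with
    | zero =>
      rw [zchoose_of_neg (b := 2 * ((0 : ℕ) : ℤ) - ((i + 1 : ℕ) : ℤ) + 2 - 3)
        (by push_cast; omega)]
      simp only [coeff_sub, h3, coeff_X_mul_zero, coeff_C_mul, coeff_stairPoly]
      push_cast
      ring_nf
    | succ j =>
      simp only [coeff_sub, h3, coeff_X_mul, coeff_C_mul, coeff_stairPoly]
      push_cast
      ring_nf

theorem det_coeff_X_sub_C_mul (m : ℕ) (t₀ : ℂ) (S : ℕ → ℂ[X]) :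
    (Matrix.of fun i j : Fin m => ((X - C t₀) * S i).coeff j).det =
      (-t₀) ^ m * (Matrix.of fun i j : Fin m => (S i).coeff j).det := by
  let Q : Matrix (Fin m) (Fin m) ℂ :=
    Matrix.of fun l j => (if l.1 + 1 = j.1 then 1 else 0) + if l = j then -t₀ else 0
  have hQ : Q.det = (-t₀) ^ m := by
    rw [Matrix.det_of_isUpperTriangular]
    · simp [Q]
    · intro l j hlj
      have h : j.1 < l.1 := hlj
      have h1 : l ≠ j := fun e => by subst e; exact lt_irrefl _ h
      simp [Q, h1]; omega
  rw [← hQ, mul_comm, ← Matrix.det_mul]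
  congr 1
  ext i j
  simp only [Matrix.mul_apply, Matrix.of_apply, Q, mul_add, Finset.sum_add_distrib, sub_mul,
    coeff_sub, coeff_C_mul]
  have h2 : ∑ l : Fin m, (S i).coeff l * (if l = j then -t₀ else 0) = -(t₀ * (S i).coeff j) := by
    simp [mul_comm]
  rw [h2, sub_eq_add_neg]
  congr 1
  obtain ⟨j, hj⟩ := j
  cases j with
  | zero => simp
  | succ j =>
    rw [coeff_X_mul, Finset.sum_eq_single (⟨j, by omega⟩ : Fin m)]
    · simp
    · intro b _ hb
      have : b.1 ≠ j := fun h => hb (Fin.ext h)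
      simp [this]
    · simp

theorem det_jetRow_stairPoly (m : ℕ) (t₀ : ℂ) :
    (Matrix.of fun i j : Fin (m + 1) => jetRow m t₀ (stairPoly i) j).det =
      t₀ ^ m * (Matrix.of fun i j : Fin m => (pencilPoly t₀ i).coeff j).det := by
  let d : ℕ → ℂ[X] := fun k => k.casesOn 1 fun k => (X - C t₀) * pencilPoly t₀ k
  have hd0 : d 0 = 1 := rfl
  have hd1 : ∀ k, d (k + 1) = (X - C t₀) * pencilPoly t₀ k := fun _ => rfl
  have hd : ∀ k, d k - stairPoly k ∈ Submodule.span ℂ (stairPoly '' Set.Iio k) := by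
    intro k
    have hmem : ∀ l < k, ∀ a : ℂ, C a * stairPoly l ∈
        Submodule.span ℂ (stairPoly '' Set.Iio k) := fun l hl a => by
      rw [← smul_eq_C_mul]
      exact Submodule.smul_mem _ _ (Submodule.subset_span ⟨l, hl, rfl⟩)
    match k with
    | 0 => simp [hd0, stairPoly]
    | 1 =>
      have e : d 1 - stairPoly 1 = C (1 - 3 * t₀ + t₀ ^ 2) * stairPoly 0 := by
        rw [show d 1 = _ from hd1 0]
        simp only [stairPoly, pencilPoly, map_add, map_sub, map_mul, map_pow, map_one, map_ofNat]
        ring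
      rw [e]; exact hmem _ (by omega) _
    | k + 2 =>
      have e : d (k + 2) - stairPoly (k + 2) =
          C (t₀ ^ 2 - 3 * t₀) * stairPoly (k + 1) + C t₀ * stairPoly k := by
        rw [hd1 (k + 1)]
        simp only [stairPoly, pencilPoly, map_sub, map_mul, map_pow, map_ofNat]
        ring
      rw [e]
      exact Submodule.add_mem _ (hmem _ (by omega) _) (hmem _ (by omega) _)
  have h1 := det_eq_prod_mul_det_of_sub_mem_span (N := m + 1) (fun k => jetRow m t₀ (d k))
    (fun k => jetRow m t₀ (stairPoly k)) (fun _ => 1) (fun j => j.1) (by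
      intro k _
      have := Submodule.mem_map_of_mem (f := jetRow m t₀) (hd k)
      rw [Submodule.map_span, ← Set.image_comp, map_sub] at this
      simpa [Function.comp_def] using this)
  simp only [Finset.prod_const_one, one_mul] at h1
  rw [← h1, Matrix.det_succ_column _ (Fin.last m), Fin.sum_univ_succ, Finset.sum_eq_zero]
  · have e : (Matrix.of fun i j : Fin (m + 1) => jetRow m t₀ (d i) j).submatrix
        (Fin.succAbove 0) (Fin.succAbove (Fin.last m)) =
        Matrix.of fun i j : Fin m => ((X - C t₀) * pencilPoly t₀ i).coeff j := by
      ext i j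
      simp [jetRow, hd1]
    rw [e, det_coeff_X_sub_C_mul, neg_pow t₀]
    simp only [jetRow, Matrix.of_apply, LinearMap.coe_mk, AddHom.coe_mk, Fin.val_last,
      lt_irrefl, if_false, Fin.val_zero, zero_add, hd0, eval_one]
    have hs : ((-1 : ℂ) ^ m) * (-1) ^ m = 1 := by rw [← mul_pow]; simp
    linear_combination (t₀ ^ m * (Matrix.of fun i j : Fin m => (pencilPoly t₀ i).coeff j).det) * hs
  · intro i _
    simp [jetRow, hd1]

theorem det_of_block_upper (a b N : ℕ) (hN : N = a + b) (A : ℕ → ℕ → ℂ)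
    (h1 : ∀ i < a, A i i = 1) (h2 : ∀ i < a, ∀ j < i, A i j = 0)
    (h3 : ∀ i j, j < a → A (a + i) j = 0) :
    (Matrix.of fun i j : Fin N => A i j).det =
      (Matrix.of fun i j : Fin b => A (a + i) (a + j)).det := by
  subst hN
  rw [← Matrix.det_submatrix_equiv_self finSumFinEquiv,
    ← Matrix.fromBlocks_toBlocks (Matrix.submatrix _ _ _)]
  have z : ((Matrix.of fun i j : Fin (a + b) => A i j).submatrix finSumFinEquiv
      finSumFinEquiv).toBlocks₂₁ = 0 := by
    ext i j
    simp [Matrix.toBlocks₂₁, h3]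
  rw [z, Matrix.det_fromBlocks_zero₂₁, Matrix.det_of_isUpperTriangular]
  · simp only [Matrix.toBlocks₁₁, Matrix.of_apply, Matrix.submatrix_apply, Matrix.toBlocks₂₂,
      finSumFinEquiv_apply_left, finSumFinEquiv_apply_right, Fin.val_castAdd, Fin.val_natAdd]
    rw [Finset.prod_eq_one (fun (i : Fin a) _ => h1 i i.2), one_mul]
  · intro i j hij
    simp [Matrix.toBlocks₁₁, h2 i i.2 j hij]

theorem prod_prod_neg_one_pow (n : ℕ) :
    ∏ j ∈ Finset.range (2 * n), ∏ i ∈ Finset.range j, (-1 : ℤˣ) ^ i = 1 := by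
  induction n with
  | zero => simp
  | succ n ih =>
    rw [show 2 * (n + 1) = 2 * n + 1 + 1 by ring, Finset.prod_range_succ, Finset.prod_range_succ,
      ih, Finset.prod_range_succ _ (2 * n), one_mul, ← mul_assoc, Int.units_mul_self,
      one_mul, pow_mul]
    simp

/-- Reordering rows from `0, 1, 2, …, 2 n - 1` to `0, 2, …, 2 n - 2, 2 n - 1, …, 3, 1` preserves
the determinant. -/
theorem det_interleave {α : Type*} (n : ℕ) (h : ℕ → α → ℂ) (x : Fin (2 * n) → α) :
    (Matrix.of fun i j : Fin (2 * n) => h i (x j)).det =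
      (Matrix.of fun i j : Fin (2 * n) =>
        h (if i.1 < n then 2 * i else 2 * (2 * n - 1 - i) + 1) (x j)).det := by
  let σ : Equiv.Perm (Fin (2 * n)) :=
    { toFun := fun i => ⟨if i.1 % 2 = 0 then i / 2 else 2 * n - 1 - i / 2, by split_ifs <;> omega⟩
      invFun := fun i =>
        ⟨if i.1 < n then 2 * i else 2 * (2 * n - 1 - i) + 1, by split_ifs <;> omega⟩
      left_inv := fun i => by ext; simp only; split_ifs <;> omega
      right_inv := fun i => by ext; simp only; split_ifs <;> omega }
  have hσ : Equiv.Perm.sign σ = 1 := by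
    rw [Equiv.Perm.sign_eq_prod_prod_Iio]
    refine Eq.trans ?_ (prod_prod_neg_one_pow n)
    rw [← Fin.prod_univ_eq_prod_range (fun j => ∏ i ∈ Finset.range j, (-1 : ℤˣ) ^ i)]
    refine Finset.prod_congr rfl fun j _ => ?_
    refine Finset.prod_bij (fun i _ => i.1) ?_ ?_ ?_ ?_
    · intro i hi; simpa using hi
    · intro a _ b _ h; exact Fin.ext h
    · intro b hb
      have hb : b < j.1 := by simpa using hb
      exact ⟨⟨b, by omega⟩, by simpa [Fin.lt_def] using hb, rfl⟩
    · intro i hi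
      have hi : i.1 < j.1 := by simpa using hi
      have : (σ i < σ j) ↔ i.1 % 2 = 0 := by
        simp only [σ, Equiv.coe_fn_mk, Fin.lt_def]
        split_ifs <;> omega
      simp only [this]
      split_ifs with h2
      · rw [Even.neg_one_pow (Nat.even_iff.2 h2)]
      · rw [Odd.neg_one_pow (Nat.odd_iff.2 (by omega))]
  have := Matrix.det_permute σ (Matrix.of fun i j : Fin (2 * n) =>
        h (if i.1 < n then 2 * i else 2 * (2 * n - 1 - i) + 1) (x j))
  rw [hσ] at this
  simp only [Units.val_one, Int.cast_one, one_mul] at this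
  rw [← this]
  congr 1
  ext i j
  simp only [Matrix.of_apply, Matrix.submatrix_apply]
  congr 1
  have := congrArg Fin.val (σ.symm_apply_apply i)
  exact this.symm

theorem mul_mem_span_image_Iio {α : Type*} {h : ℕ → α → ℂ} {c : α → ℂ} {d : ℕ} {A B : ℂ}
    (hh : ∀ l, c * h l = A • h (l + d) + B • h l) {k : ℕ} {g : α → ℂ}
    (hg : g ∈ Submodule.span ℂ (h '' Set.Iio k)) :
    c * g ∈ Submodule.span ℂ (h '' Set.Iio (k + d)) := by
  induction hg using Submodule.span_induction with
  | mem g hg =>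
    obtain ⟨l, hl, rfl⟩ := hg
    have hl : l < k := hl
    rw [hh]
    exact Submodule.add_mem _
      (Submodule.smul_mem _ _ (Submodule.subset_span ⟨l + d, by simpa using hl, rfl⟩))
      (Submodule.smul_mem _ _ (Submodule.subset_span ⟨l, by simp; omega, rfl⟩))
  | zero => simp
  | add f g _ _ hf hg => rw [mul_add]; exact Submodule.add_mem _ hf hg
  | smul r g _ hg => rw [mul_smul_comm]; exact Submodule.smul_mem _ _ hg

theorem sub_smul_mem_span_of_recurrence {α : Type*} {f h : ℕ → α → ℂ} {c : α → ℂ} {d : ℕ}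
    {A B : ℂ} {a : ℕ → ℂ} (hd : 0 < d) (hh : ∀ l, c * h l = A • h (l + d) + B • h l)
    (hf : ∀ k, f (k + 2 * d) = c * f (k + d) - f k) (ha : ∀ k, a (k + d) = A * a k)
    (hb : ∀ k < 2 * d, f k - a k • h k ∈ Submodule.span ℂ (h '' Set.Iio k)) (k : ℕ) :
    f k - a k • h k ∈ Submodule.span ℂ (h '' Set.Iio k) := by
  induction k using Nat.strong_induction_on with
  | _ k ih =>
  rcases lt_or_ge k (2 * d) with hk | hk
  · exact hb k hk
  obtain ⟨k, rfl⟩ := Nat.exists_eq_add_of_le' hk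
  have e : f (k + 2 * d) - a (k + 2 * d) • h (k + 2 * d) =
      c * (f (k + d) - a (k + d) • h (k + d)) + (a (k + d) * B) • h (k + d) -
        (f k - a k • h k) - a k • h k := by
    have e1 : a (k + 2 * d) = A * a (k + d) := by rw [← ha]; ring_nf
    have e2 := hh (k + d)
    rw [show k + d + d = k + 2 * d by ring] at e2
    rw [hf, e1, mul_sub, mul_smul_comm, e2]
    module
  have hmono : ∀ l < k + 2 * d, h '' Set.Iio l ⊆ h '' Set.Iio (k + 2 * d) := fun l hl =>
    Set.image_mono (Set.Iio_subset_Iio hl.le)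
  rw [e]
  refine Submodule.sub_mem _ (Submodule.sub_mem _ (Submodule.add_mem _ ?_ ?_) ?_) ?_
  · have := mul_mem_span_image_Iio hh (ih (k + d) (by omega))
    rwa [show k + d + d = k + 2 * d by ring] at this
  · exact Submodule.smul_mem _ _ (Submodule.subset_span ⟨k + d, by simp; omega, rfl⟩)
  · exact Submodule.span_mono (hmono k (by omega)) (ih k (by omega))
  · exact Submodule.smul_mem _ _ (Submodule.subset_span ⟨k, by simp; omega, rfl⟩)

/-- The coordinate `(z + z⁻¹ - 2) / 3`. -/
def joukowski (z : ℂ) : ℂ := (z + z⁻¹ - 2) / 3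

/-- Row functions `e ^ (k / 2) * s ^ (k % 2)`, where `e = s * (1 + s) ^ 2`. -/
def stairBasis (k : ℕ) (s : ℂ) : ℂ := (s * (1 + s) ^ 2) ^ (k / 2) * s ^ (k % 2)

theorem zpow_sub_zpow_neg_recurrence (z : ℂ) (a b : ℕ) (ha : 0 < a) (hb : 0 < b) :
    z ^ ((a + 2 * b : ℕ) : ℤ) - z ^ (-((a + 2 * b : ℕ) : ℤ)) =
      (z ^ b + (z ^ b)⁻¹) * (z ^ ((a + b : ℕ) : ℤ) - z ^ (-((a + b : ℕ) : ℤ))) -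
        (z ^ (a : ℤ) - z ^ (-(a : ℤ))) := by
  simp only [_root_.zpow_neg, zpow_natCast]
  rcases eq_or_ne z 0 with rfl | hz
  · simp [ha.ne', hb.ne']
  · field_simp
    ring

theorem det_stair_rows (N : ℕ) (z : Fin N → ℂ) (hz : ∀ j, z j ≠ 0) :
    (Matrix.of fun i j : Fin N =>
      z j ^ ((i.1 / 2 + i.1 + 1 : ℕ) : ℤ) - z j ^ (-((i.1 / 2 + i.1 + 1 : ℕ) : ℤ))).det =
      (∏ i : Fin N, 27 ^ (i.1 / 2) * 3 ^ (i.1 % 2)) * ((∏ j, (z j - (z j)⁻¹)) *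
        (Matrix.of fun i j : Fin N => stairBasis i (joukowski (z j))).det) := by
  rw [← Matrix.det_mul_row]
  let h : ℕ → {z : ℂ // z ≠ 0} → ℂ := fun k z => (z.1 - z.1⁻¹) * stairBasis k (joukowski z)
  let f : ℕ → {z : ℂ // z ≠ 0} → ℂ := fun k z =>
    z.1 ^ ((k / 2 + k + 1 : ℕ) : ℤ) - z.1 ^ (-((k / 2 + k + 1 : ℕ) : ℤ))
  let a : ℕ → ℂ := fun k => 27 ^ (k / 2) * 3 ^ (k % 2)
  refine det_eq_prod_mul_det_of_sub_mem_span f h a (fun j => ⟨z j, hz j⟩) fun k _ => ?_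
  refine sub_smul_mem_span_of_recurrence (f := f) (h := h) (a := a) (d := 2) (A := 27) (B := 2)
    (c := fun z : {z : ℂ // z ≠ 0} => z.1 ^ 3 + (z.1 ^ 3)⁻¹) two_pos ?_ ?_ ?_ ?_ k
  · intro l
    ext ⟨z, hz⟩
    simp only [h, Pi.mul_apply, Pi.add_apply, Pi.smul_apply, smul_eq_mul, stairBasis,
      Nat.add_mod_right, show (l + 2) / 2 = l / 2 + 1 by omega, pow_succ _ (l / 2)]
    have : z ^ 3 + (z ^ 3)⁻¹ = 27 * (joukowski z * (1 + joukowski z) ^ 2) + 2 := by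
      simp only [joukowski]; field_simp; ring
    rw [this]; ring
  · intro k
    ext ⟨z, hz⟩
    have := zpow_sub_zpow_neg_recurrence z (k / 2 + k + 1) 3 (by omega) (by omega)
    rw [show k / 2 + k + 1 + 2 * 3 = (k + 2 * 2) / 2 + (k + 2 * 2) + 1 by omega,
      show k / 2 + k + 1 + 3 = (k + 2) / 2 + (k + 2) + 1 by omega] at this
    exact this
  · intro k
    simp only [a, Nat.add_mod_right, show (k + 2) / 2 = k / 2 + 1 by omega]
    ring
  · have hmem : ∀ k, ∀ l < k, ∀ a : ℂ, a • h l ∈ Submodule.span ℂ (h '' Set.Iio k) :=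
      fun k l hl a => Submodule.smul_mem _ _ (Submodule.subset_span ⟨l, hl, rfl⟩)
    intro k hk
    obtain rfl | rfl | rfl | rfl : k = 0 ∨ k = 1 ∨ k = 2 ∨ k = 3 := by omega
    · convert Submodule.zero_mem _ using 1
      ext ⟨z, hz⟩
      simp [f, a, h, stairBasis]
    · convert hmem 1 0 (by omega) 2 using 1
      ext ⟨z, hz⟩
      simp [f, a, h, stairBasis, joukowski, _root_.zpow_neg]
      norm_cast
      field_simp
      ring
    · convert Submodule.add_mem _ (hmem 2 1 (by omega) 3) (hmem 2 0 (by omega) 4) using 1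
      ext ⟨z, hz⟩
      simp [f, a, h, stairBasis, joukowski, _root_.zpow_neg]
      norm_cast
      field_simp
      ring
    · convert Submodule.add_mem _ (Submodule.add_mem _ (hmem 3 2 (by omega) 54)
        (hmem 3 1 (by omega) 6)) (hmem 3 0 (by omega) 5) using 1
      ext ⟨z, hz⟩
      simp [f, a, h, stairBasis, joukowski, _root_.zpow_neg]
      norm_cast
      field_simp
      ring

theorem det_symplectic_rows (N : ℕ) (z : Fin N → ℂ) (hz : ∀ j, z j ≠ 0) :
    (Matrix.of fun i j : Fin N =>
      z j ^ ((i.1 + 1 : ℕ) : ℤ) - z j ^ (-((i.1 + 1 : ℕ) : ℤ))).det =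
      (∏ i : Fin N, 3 ^ i.1) * ((∏ j, (z j - (z j)⁻¹)) *
        (Matrix.of fun i j : Fin N => joukowski (z j) ^ i.1).det) := by
  rw [← Matrix.det_mul_row]
  let h : ℕ → {z : ℂ // z ≠ 0} → ℂ := fun k z => (z.1 - z.1⁻¹) * joukowski z ^ k
  let f : ℕ → {z : ℂ // z ≠ 0} → ℂ := fun k z =>
    z.1 ^ ((k + 1 : ℕ) : ℤ) - z.1 ^ (-((k + 1 : ℕ) : ℤ))
  let a : ℕ → ℂ := fun k => 3 ^ k
  refine det_eq_prod_mul_det_of_sub_mem_span f h a (fun j => ⟨z j, hz j⟩) fun k _ => ?_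
  refine sub_smul_mem_span_of_recurrence (f := f) (h := h) (a := a) (d := 1) (A := 3) (B := 2)
    (c := fun z : {z : ℂ // z ≠ 0} => z.1 ^ 1 + (z.1 ^ 1)⁻¹) one_pos ?_ ?_ ?_ ?_ k
  · intro l
    ext ⟨z, hz⟩
    simp only [h, Pi.mul_apply, Pi.add_apply, Pi.smul_apply, smul_eq_mul]
    have : z ^ 1 + (z ^ 1)⁻¹ = 3 * joukowski z + 2 := by
      simp only [joukowski]; field_simp; ring
    rw [this]; ring
  · intro k
    ext ⟨z, hz⟩
    have := zpow_sub_zpow_neg_recurrence z (k + 1) 1 (by omega) (by omega)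
    rw [show k + 1 + 2 * 1 = k + 2 * 1 + 1 by omega] at this
    exact this
  · intro k; simp only [a]; ring
  · intro k hk
    obtain rfl | rfl : k = 0 ∨ k = 1 := by omega
    · convert Submodule.zero_mem _ using 1
      ext ⟨z, hz⟩
      simp [f, a, h]
    · convert Submodule.smul_mem _ (2 : ℂ) (Submodule.subset_span
        (Set.mem_image_of_mem h (Set.mem_Iio.2 (Nat.zero_lt_one)))) using 1
      ext ⟨z, hz⟩
      simp [f, a, h, joukowski, _root_.zpow_neg]
      norm_cast
      field_simp
      ring

theorem sdet_rev (N : ℕ) (e : Fin N → ℕ) (z : Fin N → ℂ) :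
    sdet N e z = Equiv.Perm.sign (Fin.revPerm (n := N)) * (Matrix.of fun i j : Fin N =>
      z j ^ (e i.rev : ℤ) - z j ^ (-(e i.rev : ℤ))).det := by
  rw [sdet]
  have := Matrix.det_permute Fin.revPerm (Matrix.of fun i j : Fin N =>
      z j ^ (e i.rev : ℤ) - z j ^ (-(e i.rev : ℤ)))
  rw [← this]
  congr 1
  ext i j
  simp

theorem prod_stair_constants (n : ℕ) :
    ∏ i : Fin (2 * n), (27 ^ (i.1 / 2) * 3 ^ (i.1 % 2) : ℂ) =
      3 ^ (n * (n - 1)) * ∏ i : Fin (2 * n), 3 ^ i.1 := by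
  rw [Fin.prod_univ_eq_prod_range (fun i => (27 ^ (i / 2) * 3 ^ (i % 2) : ℂ)),
    Fin.prod_univ_eq_prod_range (fun i => (3 ^ i : ℂ))]
  induction n with
  | zero => simp
  | succ n ih =>
    rw [show 2 * (n + 1) = 2 * n + 1 + 1 by ring, prod_range_succ, prod_range_succ, ih,
      prod_range_succ _ (2 * n + 1), prod_range_succ _ (2 * n),
      show 2 * n / 2 = n by omega, show (2 * n + 1) / 2 = n by omega,
      show 2 * n % 2 = 0 by omega, show (2 * n + 1) % 2 = 1 by omega, Nat.add_sub_cancel,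
      show (27 : ℂ) = 3 ^ 3 by norm_num]
    simp only [← pow_mul]
    have : (n + 1) * n = n * (n - 1) + 2 * n := by
      cases n with
      | zero => rfl
      | succ n => simp; ring
    rw [this]
    ring

theorem IsSymplecticExt.apply_eq {n : ℕ} {X : (Fin (2 * n) → ℂ) → ℂ}
    (hX : IsSymplecticExt (2 * n) X) (z : Fin (2 * n) → ℂ) (hz : ∀ j, z j ≠ 0)
    (hz' : ∀ j, z j ^ 2 ≠ 1) (hs : Function.Injective fun j => joukowski (z j)) :
    X z = 3 ^ (n * (n - 1)) *
      ((Matrix.of fun i j : Fin (2 * n) => stairBasis i (joukowski (z j))).det /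
        (Matrix.of fun i j : Fin (2 * n) => joukowski (z j) ^ i.1).det) := by
  have h1 : ∏ j, (z j - (z j)⁻¹) ≠ 0 := Finset.prod_ne_zero_iff.2 fun j _ h => hz' j <| by
    have := hz j
    field_simp at h
    linear_combination h
  have h2 : (Matrix.of fun i j : Fin (2 * n) => joukowski (z j) ^ i.1).det ≠ 0 := by
    have := Matrix.det_vandermonde_ne_zero_iff.2 hs
    rwa [← Matrix.det_transpose] at this
  have h3 : (∏ i : Fin (2 * n), (3 : ℂ) ^ i.1) ≠ 0 :=
    Finset.prod_ne_zero_iff.2 fun j _ => pow_ne_zero _ three_ne_zero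
  have hmu : ∀ i : Fin (2 * n), muE (2 * n) i.rev = i.1 / 2 + i.1 + 1 := fun i => by
    simp only [muE, Fin.val_rev]; omega
  have hde : ∀ i : Fin (2 * n), deltaE (2 * n) i.rev = i.1 + 1 := fun i => by
    simp only [deltaE, Fin.val_rev]; omega
  have hsgn : ((Equiv.Perm.sign (Fin.revPerm (n := 2 * n)) : ℤ) : ℂ) ≠ 0 := by
    exact_mod_cast (Equiv.Perm.sign (Fin.revPerm (n := 2 * n))).ne_zero
  have hnum := sdet_rev _ (muE (2 * n)) z
  have hden := sdet_rev _ (deltaE (2 * n)) z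
  simp only [hmu] at hnum
  simp only [hde] at hden
  rw [det_stair_rows _ z hz, prod_stair_constants] at hnum
  rw [det_symplectic_rows _ z hz] at hden
  rw [hX.2 z hz, hnum, hden]
  · generalize ∏ j, (z j - (z j)⁻¹) = P at h1
    field_simp
  · rw [hden]
    exact mul_ne_zero hsgn (mul_ne_zero h3 (mul_ne_zero h1 h2))

theorem sub_mem_span_of_four_term {α : Type*} {n : ℕ} {f G : ℕ → α → ℂ} {E : α → ℂ}
    (hE1 : ∀ l, n ≤ l → l + 1 < 2 * n → E * G l = G (l + 1))
    (hE2 : ∀ l, l + 1 < n → E * G (l + 1) = G l)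
    (hf0 : f n = G n) (hf1 : f (n + 1) = E * G n + G n - G (n - 1))
    (hf2 : f (n + 2) = E * f (n + 1) + 3 • f (n + 1) - 3 • f n + G (n - 1) + G n)
    (hf3 : ∀ i, f (n + (i + 3)) =
      E * f (n + (i + 2)) + 3 • f (n + (i + 2)) - 3 • f (n + (i + 1)) + f (n + i))
    (i : ℕ) (hi : i < n) :
    f (n + i) - G (n + i) ∈ Submodule.span ℂ (G '' Set.Ico (n - 1 - i) (n + i)) := by
  let V : ℕ → Submodule ℂ (α → ℂ) := fun i => Submodule.span ℂ (G '' Set.Ico (n - 1 - i) (n + i))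
  change f (n + i) - G (n + i) ∈ V i
  have hG : ∀ i l, n - 1 - i ≤ l → l < n + i → G l ∈ V i := fun i l h1 h2 =>
    Submodule.subset_span ⟨l, ⟨h1, h2⟩, rfl⟩
  have hmono : ∀ {i j}, i ≤ j → V i ≤ V j := fun {i j} hij =>
    Submodule.span_mono (Set.image_mono (Set.Ico_subset_Ico (by omega) (by omega)))
  have hEV : ∀ i, i + 1 < n → ∀ g ∈ V i, E * g ∈ V (i + 1) := by
    intro i hi g hg
    induction hg using Submodule.span_induction with
    | mem g hg =>
      obtain ⟨l, ⟨hl1, hl2⟩, rfl⟩ := hg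
      rcases lt_or_ge l n with h | h
      · obtain ⟨l, rfl⟩ := Nat.exists_eq_add_of_le' (show 1 ≤ l by omega)
        rw [hE2 l h]
        exact hG _ _ (by omega) (by omega)
      · rw [hE1 l h (by omega)]
        exact hG _ _ (by omega) (by omega)
    | zero => simp
    | add f g _ _ hf hg => rw [mul_add]; exact Submodule.add_mem _ hf hg
    | smul r g _ hg => rw [mul_smul_comm]; exact Submodule.smul_mem _ _ hg
  induction i using Nat.strong_induction_on with
  | _ i ih =>
  have hf : ∀ j < i, j < n → f (n + j) ∈ V i := fun j hj hjn => by
    have := Submodule.add_mem _ (hmono hj.le (ih j hj hjn)) (hG i (n + j) (by omega) (by omega))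
    rwa [sub_add_cancel] at this
  have hstep : ∀ j, j + 1 = i → E * f (n + j) - G (n + i) ∈ V i := by
    rintro j rfl
    have := hEV j hi _ (ih j (by omega) (by omega))
    rwa [mul_sub, hE1 _ (by omega) (by omega)] at this
  match i with
  | 0 => simp [hf0]
  | 1 =>
    rw [hf1, hE1 n le_rfl (by omega)]
    have := Submodule.sub_mem _ (hG 1 n (by omega) (by omega)) (hG 1 (n - 1) (by omega) (by omega))
    convert this using 1
    abel
  | 2 =>
    have := Submodule.add_mem _ (Submodule.add_mem _ (Submodule.sub_mem _ (Submodule.add_mem _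
      (hstep 1 rfl) ((V 2).smul_of_tower_mem 3 (hf 1 (by omega) (by omega))))
      ((V 2).smul_of_tower_mem 3 (hf 0 (by omega) (by omega))))
      (hG 2 (n - 1) (by omega) (by omega))) (hG 2 n (by omega) (by omega))
    convert this using 1
    rw [hf2, add_zero]
    abel
  | i + 3 =>
    have := Submodule.add_mem _ (Submodule.sub_mem _ (Submodule.add_mem _
      (hstep (i + 2) rfl) ((V (i + 3)).smul_of_tower_mem 3 (hf (i + 2) (by omega) (by omega))))
      ((V (i + 3)).smul_of_tower_mem 3 (hf (i + 1) (by omega) (by omega))))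
      (hf i (by omega) (by omega))
    convert this using 1
    rw [hf3]
    abel

/-- Polynomial rows spanning the same space as the functions `stairBasis`, in the coordinate
`t = s / (1 + s)` and after clearing denominators. -/
def stairRow (n k : ℕ) : ℂ[X] :=
  if k < n then X ^ k * (1 - X) ^ (3 * (n - k) - 2) else X ^ n * stairPoly (k - n)

theorem det_stairBasis_mul_prod {n : ℕ} (hn : 1 ≤ n) (t : Fin (2 * n) → ℂ) (h0 : ∀ j, t j ≠ 0)
    (h1 : ∀ j, t j ≠ 1) :
    (∏ j, (1 - t j) ^ (3 * n - 2)) *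
        (Matrix.of fun i j : Fin (2 * n) => stairBasis i (t j / (1 - t j))).det =
      (Matrix.of fun i j : Fin (2 * n) => (stairRow n i).eval (t j)).det := by
  let x : Fin (2 * n) → {t : ℂ // t ≠ 0 ∧ t ≠ 1} := fun j => ⟨t j, h0 j, h1 j⟩
  let f : ℕ → {t : ℂ // t ≠ 0 ∧ t ≠ 1} → ℂ := fun k t =>
    ((1 - t.1) ^ (3 * n - 2))⁻¹ * (stairRow n k).eval t.1
  let G : ℕ → {t : ℂ // t ≠ 0 ∧ t ≠ 1} → ℂ := fun k t =>
    stairBasis (if k < n then 2 * k else 2 * (2 * n - 1 - k) + 1) (t.1 / (1 - t.1))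
  let E : {t : ℂ // t ≠ 0 ∧ t ≠ 1} → ℂ := fun t => (1 - t.1) ^ 3 / t.1
  have hG1 : ∀ k < n, ∀ t, G k t = t.1 ^ k / (1 - t.1) ^ (3 * k) := by
    rintro k hk ⟨t, ht0, ht1⟩
    have : 1 - t ≠ 0 := sub_ne_zero.2 ht1.symm
    have e : t / (1 - t) * (1 + t / (1 - t)) ^ 2 = t / (1 - t) ^ 3 := by field_simp; ring
    simp only [G, hk, if_true, stairBasis, e, Nat.mul_mod_right, pow_zero, div_one, mul_one,
      show 2 * k / 2 = k by omega, div_pow, pow_mul]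
  have hG2 : ∀ k < n, ∀ t, G (2 * n - 1 - k) t = t.1 ^ (k + 1) / (1 - t.1) ^ (3 * k + 1) := by
    rintro k hk ⟨t, ht0, ht1⟩
    have : 1 - t ≠ 0 := sub_ne_zero.2 ht1.symm
    have e : t / (1 - t) * (1 + t / (1 - t)) ^ 2 = t / (1 - t) ^ 3 := by field_simp; ring
    simp only [G, show ¬ (2 * n - 1 - k < n) by omega, if_false, stairBasis, e,
      show 2 * n - 1 - (2 * n - 1 - k) = k by omega, show (2 * k + 1) / 2 = k by omega,
      show (2 * k + 1) % 2 = 1 by omega, div_pow, pow_add, pow_mul, pow_one]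
    field_simp
  have hf1 : ∀ k < n, f k = G k := by
    intro k hk
    ext ⟨t, ht0, ht1⟩
    have : 1 - t ≠ 0 := sub_ne_zero.2 ht1.symm
    rw [hG1 k hk]
    simp only [f, stairRow, hk, if_true, eval_mul, eval_pow, eval_X, eval_sub, eval_one]
    rw [show 3 * n - 2 = 3 * (n - k) - 2 + 3 * k by omega, pow_add]
    field_simp
  have hf2 : ∀ i t, f (n + i) t = t.1 ^ n / (1 - t.1) ^ (3 * n - 2) * (stairPoly i).eval t.1 := by
    rintro i ⟨t, ht0, ht1⟩
    simp only [f, stairRow, show ¬ (n + i < n) by omega, if_false, eval_mul, eval_pow, eval_X,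
      Nat.add_sub_cancel_left]
    ring
  have hGn : ∀ t, G n t = t.1 ^ n / (1 - t.1) ^ (3 * n - 2) := by
    intro t
    have := hG2 (n - 1) (by omega) t
    rwa [show 2 * n - 1 - (n - 1) = n by omega, show n - 1 + 1 = n by omega,
      show 3 * (n - 1) + 1 = 3 * n - 2 by omega] at this
  have hGn' : ∀ t, G (n - 1) t = t.1 ^ n / (1 - t.1) ^ (3 * n - 2) * ((1 - t.1) / t.1) := by
    rintro ⟨t, ht0, ht1⟩
    have : 1 - t ≠ 0 := sub_ne_zero.2 ht1.symm
    rw [hG1 (n - 1) (by omega), show 3 * n - 2 = 3 * (n - 1) + 1 by omega]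
    nth_rewrite 3 [show n = n - 1 + 1 by omega]
    rw [pow_succ, pow_succ]
    field_simp
  have key := sub_mem_span_of_four_term (n := n) (f := f) (G := G) (E := E) ?_ ?_ ?_ ?_ ?_ ?_
  rotate_left
  · intro l hl1 hl2
    ext ⟨t, ht0, ht1⟩
    have : 1 - t ≠ 0 := sub_ne_zero.2 ht1.symm
    obtain ⟨k, rfl⟩ : ∃ k, l = 2 * n - 1 - (k + 1) := ⟨2 * n - 2 - l, by omega⟩
    rw [show 2 * n - 1 - (k + 1) + 1 = 2 * n - 1 - k by omega, Pi.mul_apply,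
      hG2 _ (by omega), hG2 _ (by omega)]
    simp only [E]
    rw [show 3 * (k + 1) + 1 = 3 * k + 1 + 3 by ring, pow_add _ (3 * k + 1), pow_succ _ (k + 1)]
    field_simp
  · intro l hl
    ext ⟨t, ht0, ht1⟩
    have : 1 - t ≠ 0 := sub_ne_zero.2 ht1.symm
    rw [Pi.mul_apply, hG1 _ (by omega), hG1 _ (by omega)]
    simp only [E]
    rw [show 3 * (l + 1) = 3 * l + 3 by ring, pow_add _ (3 * l), pow_succ _ l]
    field_simp
  · ext t
    have := hf2 0 t
    rw [add_zero] at this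
    simp [this, hGn, stairPoly]
  · ext t
    have ht0 := t.2.1
    simp only [Pi.add_apply, Pi.sub_apply, Pi.mul_apply, hf2, hGn, hGn', E, stairPoly, eval_neg,
      eval_add, eval_sub, eval_mul, eval_one, eval_ofNat, eval_X, eval_pow]
    generalize t.1 ^ n / (1 - t.1) ^ (3 * n - 2) = c
    field_simp
    ring
  · ext t
    have ht0 := t.2.1
    have hfn := hf2 0 t
    rw [add_zero] at hfn
    simp only [Pi.add_apply, Pi.sub_apply, Pi.mul_apply, Pi.smul_apply, hfn, hf2, hGn, hGn', E,
      stairPoly, eval_neg, eval_add, eval_sub, eval_mul, eval_one, eval_ofNat, eval_X, eval_pow]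
    generalize t.1 ^ n / (1 - t.1) ^ (3 * n - 2) = c
    field_simp
    ring
  · intro i
    ext t
    have ht0 := t.2.1
    simp only [Pi.add_apply, Pi.sub_apply, Pi.mul_apply, Pi.smul_apply, hf2, E,
      stairPoly, eval_sub, eval_mul, eval_ofNat, eval_X, eval_pow]
    generalize t.1 ^ n / (1 - t.1) ^ (3 * n - 2) = c
    generalize eval t.1 (stairPoly (i + 1)) = p
    generalize eval t.1 (stairPoly i) = p'
    field_simp
    ring
  have hdet := det_eq_prod_mul_det_of_sub_mem_span f G (fun _ => 1) x (fun k hk => by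
    rw [one_smul]
    rcases lt_or_ge k n with h | h
    · simp [hf1 k h]
    · obtain ⟨i, rfl⟩ := Nat.exists_eq_add_of_le h
      exact Submodule.span_mono (Set.image_mono fun l hl => hl.2) (key i (by omega)))
  rw [Finset.prod_const_one, one_mul] at hdet
  rw [det_interleave n (fun k (t : {t : ℂ // t ≠ 0 ∧ t ≠ 1}) => stairBasis k (t.1 / (1 - t.1))) x,
    ← hdet, ← Matrix.det_mul_row]
  congr 1
  ext i j
  have : 1 - t j ≠ 0 := sub_ne_zero.2 (h1 j).symm
  simp only [Matrix.of_apply, f, x]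
  field_simp

theorem prod_mul_det_pow_div (M : ℕ) (t : Fin (M + 1) → ℂ) (h1 : ∀ j, t j ≠ 1) :
    (∏ j, (1 - t j) ^ M) *
        (Matrix.of fun i j : Fin (M + 1) => (t j / (1 - t j)) ^ i.1).det =
      (Matrix.vandermonde t).det := by
  have e : (Matrix.of fun i j : Fin (M + 1) => (1 - t j) ^ M * (t j / (1 - t j)) ^ i.1) =
      (Matrix.projVandermonde t fun j => 1 - t j)ᵀ := by
    ext i j
    have : 1 - t j ≠ 0 := sub_ne_zero.2 (h1 j).symm
    have hM : (1 - t j) ^ M = (1 - t j) ^ i.1 * (1 - t j) ^ i.rev.1 := by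
      rw [← pow_add, show i.1 + i.rev.1 = M by simp only [Fin.val_rev]; omega]
    rw [Matrix.transpose_apply, Matrix.projVandermonde_apply, Matrix.of_apply, hM, div_pow]
    field_simp
  rw [← Matrix.det_mul_row]
  simp only [Matrix.of_apply]
  rw [e, Matrix.det_transpose, Matrix.det_projVandermonde, Matrix.det_vandermonde]
  refine Finset.prod_congr rfl fun i _ => Finset.prod_congr rfl fun j _ => ?_
  ring

theorem det_jetRow_stairRow (m : ℕ) (t₀ : ℂ) :
    (Matrix.of fun i j : Fin (2 * m + 1 + 1) => jetRow (2 * m + 1) t₀ (stairRow (m + 1) i) j).det =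
      t₀ ^ (2 * m + 1) * (Matrix.of fun i j : Fin m => (pencilPoly t₀ i).coeff j).det := by
  have hlow : ∀ (p : ℂ[X]) (k j : ℕ), j < k → (X ^ k * p).coeff j = 0 := fun p k j h => by
    rw [coeff_X_pow_mul', if_neg (by omega)]
  rw [det_of_block_upper (m + 1) (m + 1) _ (by ring)
    (fun i j => jetRow (2 * m + 1) t₀ (stairRow (m + 1) i) j)]
  · have e : (Matrix.of fun i j : Fin (m + 1) =>
        jetRow (2 * m + 1) t₀ (stairRow (m + 1) (m + 1 + i)) (m + 1 + j)) =
        Matrix.of fun i j : Fin (m + 1) =>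
          (if j.1 < m then 1 else t₀ ^ (m + 1)) * jetRow m t₀ (stairPoly i) j := by
      ext i j
      have h : m + 1 + j.1 < 2 * m + 1 ↔ j.1 < m := by omega
      simp only [Matrix.of_apply, jetRow, stairRow, LinearMap.coe_mk, AddHom.coe_mk, h,
        show ¬ (m + 1 + i.1 < m + 1) by omega, if_false, Nat.add_sub_cancel_left]
      split_ifs
      · rw [one_mul, add_comm (m + 1) j.1, coeff_X_pow_mul]
      · simp
    rw [e]
    have := Matrix.det_mul_row (fun j : Fin (m + 1) => if j.1 < m then (1 : ℂ) else t₀ ^ (m + 1))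
      (Matrix.of fun i j : Fin (m + 1) => jetRow m t₀ (stairPoly i) j)
    simp only [Matrix.of_apply] at this
    rw [this, det_jetRow_stairPoly, Fin.prod_univ_castSucc]
    simp
    ring
  · intro i hi
    simp only [jetRow, LinearMap.coe_mk, AddHom.coe_mk, show i < 2 * m + 1 by omega, if_true,
      stairRow, hi]
    have := coeff_X_pow_mul ((1 - X : ℂ[X]) ^ (3 * (m + 1 - i) - 2)) i 0
    rw [zero_add] at this
    rw [this, coeff_zero_eq_eval_zero]
    simp
  · intro i hi j hj
    simp only [jetRow, LinearMap.coe_mk, AddHom.coe_mk, show j < 2 * m + 1 by omega, if_true,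
      stairRow, hi]
    exact hlow _ _ _ hj
  · intro i j hj
    simp only [jetRow, LinearMap.coe_mk, AddHom.coe_mk, show j < 2 * m + 1 by omega, if_true,
      stairRow, show ¬ (m + 1 + i < m + 1) by omega, if_false]
    exact hlow _ _ _ hj

/-- The coordinate `s / (1 + s)` for `s = joukowski z`. -/
def joukowskiRatio (z : ℂ) : ℂ := (z - 1) ^ 2 / (z ^ 2 + z + 1)

theorem one_sub_joukowskiRatio {z : ℂ} (h : z ^ 2 + z + 1 ≠ 0) :
    1 - joukowskiRatio z = 3 * z / (z ^ 2 + z + 1) := by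
  rw [joukowskiRatio, eq_div_iff h, sub_mul, div_mul_cancel₀ _ h]
  ring

theorem joukowskiRatio_ne_one {z : ℂ} (hz : z ≠ 0) (h : z ^ 2 + z + 1 ≠ 0) :
    joukowskiRatio z ≠ 1 := fun e => by
  have := one_sub_joukowskiRatio h
  rw [e, sub_self] at this
  exact div_ne_zero (mul_ne_zero three_ne_zero hz) h this.symm

theorem joukowskiRatio_div_one_sub {z : ℂ} (hz : z ≠ 0) (h : z ^ 2 + z + 1 ≠ 0) :
    joukowskiRatio z / (1 - joukowskiRatio z) = joukowski z := by
  rw [one_sub_joukowskiRatio h, joukowskiRatio, joukowski, div_div_div_cancel_right₀ h]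
  field_simp
  ring

theorem one_div_one_sub_joukowskiRatio {z : ℂ} (hz : z ≠ 0) (h : z ^ 2 + z + 1 ≠ 0) :
    (1 - joukowskiRatio z)⁻¹ = 1 + joukowski z := by
  rw [one_sub_joukowskiRatio h, joukowski]
  field_simp
  ring

theorem continuousAt_joukowskiRatio {z : ℂ} (h : z ^ 2 + z + 1 ≠ 0) :
    ContinuousAt joukowskiRatio z := by
  unfold joukowskiRatio
  fun_prop (disch := assumption)

theorem eq_or_mul_eq_one_of_joukowski_eq {z w : ℂ} (hz : z ≠ 0) (hw : w ≠ 0)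
    (h : joukowski z = joukowski w) : z = w ∨ z * w = 1 := by
  have : (z - w) * (z * w - 1) = 0 := by
    simp only [joukowski] at h
    field_simp at h
    linear_combination h
  rcases mul_eq_zero.1 this with h | h
  · exact Or.inl (sub_eq_zero.1 h)
  · exact Or.inr (sub_eq_zero.1 h)

theorem det_stairBasis_div_det_pow {m : ℕ} {Φ : (Fin (2 * m + 1 + 1) → ℂ) → ℂ}
    (hΦ : ∀ t, (Matrix.of fun i j : Fin (2 * m + 1 + 1) => (stairRow (m + 1) i).eval (t j)).det =
      Φ t * (Matrix.vandermonde t).det)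
    (z : Fin (2 * m + 1 + 1) → ℂ) (hz : ∀ j, z j ≠ 0) (hz1 : ∀ j, z j ^ 2 ≠ 1)
    (hz' : ∀ j, z j ^ 2 + z j + 1 ≠ 0) (hs : Function.Injective fun j => joukowski (z j)) :
    (Matrix.of fun i j : Fin (2 * m + 1 + 1) => stairBasis i (joukowski (z j))).det /
        (Matrix.of fun i j : Fin (2 * m + 1 + 1) => joukowski (z j) ^ i.1).det =
      (∏ j, (1 - joukowskiRatio (z j)) ^ m)⁻¹ * Φ fun j => joukowskiRatio (z j) := by
  have h0 : ∀ j, joukowskiRatio (z j) ≠ 0 := fun j => by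
    refine div_ne_zero (pow_ne_zero _ (sub_ne_zero.2 fun h => hz1 j ?_)) (hz' j)
    rw [h, one_pow]
  have h1 : ∀ j, joukowskiRatio (z j) ≠ 1 := fun j => joukowskiRatio_ne_one (hz j) (hz' j)
  have e1 := det_stairBasis_mul_prod (n := m + 1) (by omega) (fun j => joukowskiRatio (z j)) h0 h1
  have e2 := prod_mul_det_pow_div (2 * m + 1) (fun j => joukowskiRatio (z j)) h1
  simp only [joukowskiRatio_div_one_sub (hz _) (hz' _)] at e1 e2
  have hV : (Matrix.vandermonde fun j => joukowskiRatio (z j)).det ≠ 0 :=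
    Matrix.det_vandermonde_ne_zero_iff.2 fun i j hij => hs <| by
      simp only [← joukowskiRatio_div_one_sub (hz _) (hz' _)]
      have hij : joukowskiRatio (z i) = joukowskiRatio (z j) := hij
      rw [hij]
  have hP : ∀ k, ∏ j, (1 - joukowskiRatio (z j)) ^ k ≠ 0 := fun k =>
    Finset.prod_ne_zero_iff.2 fun j _ => pow_ne_zero _ (sub_ne_zero.2 (h1 j).symm)
  have e3 : ∏ j, (1 - joukowskiRatio (z j)) ^ (3 * (m + 1) - 2) =
      (∏ j, (1 - joukowskiRatio (z j)) ^ m) * ∏ j, (1 - joukowskiRatio (z j)) ^ (2 * m + 1) := by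
    rw [← Finset.prod_mul_distrib]
    refine Finset.prod_congr rfl fun j _ => ?_
    rw [← pow_add]
    congr 1
    omega
  have e4 := hΦ fun j => joukowskiRatio (z j)
  rw [← e2] at e4
  rw [← e2] at hV
  have hp := hP m
  have hp' := hP (2 * m + 1)
  have hd := (mul_ne_zero_iff.1 hV).2
  rw [div_eq_iff hd]
  refine mul_left_cancel₀ (mul_ne_zero hp hp') (Eq.trans ?_ ((e1.trans e4).trans ?_))
  · rw [← e3]
    rfl
  · field_simp

theorem det_neg_one_pow_mul (m : ℕ) (A : ℕ → ℕ → ℂ) :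
    (Matrix.of fun i j : Fin m => (-1) ^ (i.1 + j.1) * A i j).det =
      (Matrix.of fun i j : Fin m => A i j).det := by
  have h1 := Matrix.det_mul_column (fun i : Fin m => (-1 : ℂ) ^ i.1)
    (Matrix.of fun i j : Fin m => (-1) ^ j.1 * A i j)
  have h2 := Matrix.det_mul_row (fun i : Fin m => (-1 : ℂ) ^ i.1)
    (Matrix.of fun i j : Fin m => A i j)
  simp only [Matrix.of_apply] at h1 h2
  rw [h2, ← mul_assoc, ← Finset.prod_mul_distrib] at h1
  simp only [pow_add, mul_assoc]
  rw [h1]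
  simp [← mul_pow]

/-- The limiting value of the symplectic character, up to a power of `3`. -/
def stairDet (m : ℕ) (s : ℂ) : ℂ :=
  (Matrix.of fun i j : Fin m =>
    (1 + s) * (zchoose ((i.1 : ℤ) + j.1 + 3) (2 * (j.1 : ℤ) - i.1 + 2) : ℂ) -
      s * (zchoose ((i.1 : ℤ) + j.1 + 1) (2 * (j.1 : ℤ) - i.1 + 1) : ℂ)).det

theorem continuous_stairDet (m : ℕ) : Continuous (stairDet m) := by
  refine Continuous.matrix_det (continuous_matrix fun i j => ?_)
  simp only [Matrix.of_apply]
  fun_prop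

theorem inv_pow_mul_det_pencilPoly (m : ℕ) {z : ℂ} (hz : z ≠ 0) (h : z ^ 2 + z + 1 ≠ 0) :
    ((1 - joukowskiRatio z) ^ m)⁻¹ *
        (Matrix.of fun i j : Fin m => (pencilPoly (joukowskiRatio z) i).coeff j).det =
      stairDet m (joukowski z) := by
  have e := det_neg_one_pow_mul m fun i j =>
    (zchoose ((i : ℤ) + j + 3) (2 * (j : ℤ) - i + 2) : ℂ) -
      joukowskiRatio z * zchoose ((i : ℤ) + j + 1) (2 * (j : ℤ) - i + 1)
  have h1 : 1 - joukowskiRatio z ≠ 0 := sub_ne_zero.2 (joukowskiRatio_ne_one hz h).symm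
  simp only [coeff_pencilPoly]
  rw [e, stairDet, ← inv_pow]
  have := Matrix.det_smul (Matrix.of fun i j : Fin m =>
    (zchoose ((i.1 : ℤ) + j.1 + 3) (2 * (j.1 : ℤ) - i.1 + 2) : ℂ) -
      joukowskiRatio z * zchoose ((i.1 : ℤ) + j.1 + 1) (2 * (j.1 : ℤ) - i.1 + 1))
    (1 - joukowskiRatio z)⁻¹
  rw [Fintype.card_fin] at this
  rw [← this]
  congr 1
  ext i j
  rw [← one_div_one_sub_joukowskiRatio hz h, ← joukowskiRatio_div_one_sub hz h]
  simp only [Matrix.smul_apply, Matrix.of_apply, smul_eq_mul]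
  ring

theorem IsSymplecticExt.continuousAt {N : ℕ} {X : (Fin N → ℂ) → ℂ} (hX : IsSymplecticExt N X)
    {z : Fin N → ℂ} (hz : ∀ j, z j ≠ 0) : ContinuousAt X z := by
  refine hX.1.continuousAt (IsOpen.mem_nhds ?_ hz)
  simp only [Set.ofPred_forall]
  exact isOpen_iInter_of_finite fun j => isOpen_ne_fun (continuous_apply j) continuous_const

theorem IsSymplecticExt.apply_ones_of_im_ne_zero {m : ℕ} {X : (Fin (2 * (m + 1)) → ℂ) → ℂ}
    (hX : IsSymplecticExt (2 * (m + 1)) X) {w : ℂ} (hw : w.im ≠ 0) (hw' : w ^ 2 + w + 1 ≠ 0) :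
    X (fun i => if i.1 < 2 * m + 1 then 1 else w) =
      3 ^ ((m + 1) * m) * stairDet m (joukowski w) := by
  obtain ⟨Φ, hΦc, hΦ, hΦ'⟩ :=
    exists_continuous_eq_mul_det_vandermonde (2 * m + 1) (stairRow (m + 1))
  have hw0 : w ≠ 0 := fun h => hw (by simp [h])
  let z : ℝ → Fin (2 * m + 1 + 1) → ℂ := fun ε j =>
    if j.1 < 2 * m + 1 then ((1 + ε * (j.1 + 1) : ℝ) : ℂ) else w
  have hzc : Continuous z := by
    refine continuous_pi fun j => ?_
    simp only [z]
    split_ifs <;> fun_prop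
  have hz0 : z 0 = fun i => if i.1 < 2 * m + 1 then 1 else w := by
    ext j
    simp [z]
  have hne : ∀ ε ≥ 0, ∀ j, z ε j ≠ 0 := by
    intro ε hε j
    simp only [z]
    split_ifs
    · have : 0 < 1 + ε * ((j.1 : ℝ) + 1) := by positivity
      exact_mod_cast this.ne'
    · exact hw0
  have hcyc : ∀ ε ≥ 0, ∀ j, z ε j ^ 2 + z ε j + 1 ≠ 0 := by
    intro ε hε j
    simp only [z]
    split_ifs
    · have : 0 < (1 + ε * ((j.1 : ℝ) + 1)) ^ 2 + (1 + ε * ((j.1 : ℝ) + 1)) + 1 := by positivity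
      exact_mod_cast this.ne'
    · exact hw'
  have hsq : ∀ ε > 0, ∀ j, z ε j ^ 2 ≠ 1 := by
    intro ε hε j
    simp only [z]
    split_ifs
    · have h : 0 < ε * ((j.1 : ℝ) + 1) := by positivity
      have : 1 < (1 + ε * ((j.1 : ℝ) + 1)) ^ 2 := by nlinarith
      exact_mod_cast this.ne'
    · intro h
      rcases sq_eq_sq_iff_eq_or_eq_neg.1 (h.trans (one_pow 2).symm) with rfl | rfl <;> simp at hw
  have hinj : ∀ ε > 0, Function.Injective fun j => joukowski (z ε j) := by
    intro ε hε i j hij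
    have hpos : ∀ k : Fin (2 * m + 1 + 1), 0 < ε * ((k.1 : ℝ) + 1) := fun k => by positivity
    have hmix : ∀ r : ℝ, 0 < r → (r : ℂ) ≠ w ∧ (r : ℂ) * w ≠ 1 := fun r hr =>
      ⟨fun h => hw (by rw [← h, Complex.ofReal_im]), fun h => by
        have := congrArg Complex.im h
        simp [hr.ne', hw] at this⟩
    have hcase := eq_or_mul_eq_one_of_joukowski_eq (hne ε hε.le i) (hne ε hε.le j) hij
    simp only [z] at hcase
    split_ifs at hcase with h1 h2 h2
    · norm_cast at hcase
      push_cast at hcase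
      rcases hcase with h | h
      · have : (i.1 : ℝ) = j.1 := by
          have : ε * ((i.1 : ℝ) - j.1) = 0 := by linarith
          rcases mul_eq_zero.1 this with h | h <;> linarith
        exact Fin.ext (by exact_mod_cast this)
      · nlinarith [hpos i, hpos j, mul_pos (hpos i) (hpos j)]
    · have := hmix _ (add_pos one_pos (hpos i))
      tauto
    · have := hmix _ (add_pos one_pos (hpos j))
      rcases hcase with h | h
      · exact absurd h.symm this.1
      · exact absurd ((mul_comm _ _).trans h) this.2
    · exact Fin.ext (by omega)
  let R : (Fin (2 * m + 1 + 1) → ℂ) → ℂ := fun z =>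
    3 ^ ((m + 1) * m) * ((∏ j, (1 - joukowskiRatio (z j)) ^ m)⁻¹ *
      Φ fun j => joukowskiRatio (z j))
  have hR : ContinuousAt R (z 0) := by
    have hc : ∀ j, ContinuousAt (fun y : Fin (2 * m + 1 + 1) → ℂ => joukowskiRatio (y j)) (z 0) :=
      fun j => (continuousAt_joukowskiRatio (hcyc 0 le_rfl j)).comp
        (f := fun y : Fin (2 * m + 1 + 1) → ℂ => y j) (continuous_apply j).continuousAt
    refine continuousAt_const.mul (ContinuousAt.mul (ContinuousAt.inv₀ ?_ ?_) ?_)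
    · exact tendsto_finsetProd _ fun j _ => (continuousAt_const.sub (hc j)).pow m
    · exact Finset.prod_ne_zero_iff.2 fun j _ => pow_ne_zero _ <| sub_ne_zero.2
        (joukowskiRatio_ne_one (hne 0 le_rfl j) (hcyc 0 le_rfl j)).symm
    · exact hΦc.continuousAt.comp (continuousAt_pi.2 hc)
  have hlim : X (z 0) = R (z 0) := by
    have hXc : ContinuousAt X (z 0) := hX.continuousAt (hne 0 le_rfl)
    have h1 := (hXc.comp hzc.continuousAt).tendsto.mono_left (nhdsWithin_le_nhds (s := Set.Ioi 0))
    have h2 := (hR.comp hzc.continuousAt).tendsto.mono_left (nhdsWithin_le_nhds (s := Set.Ioi 0))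
    refine tendsto_nhds_unique_of_eventuallyEq h1 h2 ?_
    filter_upwards [self_mem_nhdsWithin] with ε hε
    have hε : 0 < ε := hε
    have h3 := hX.apply_eq (z ε) (hne ε hε.le) (hsq ε hε) (hinj ε hε)
    have h4 := det_stairBasis_div_det_pow hΦ (z ε) (hne ε hε.le) (hsq ε hε) (hcyc ε hε.le)
      (hinj ε hε)
    exact h3.trans (congrArg (fun c => 3 ^ ((m + 1) * m) * c) h4)
  rw [hz0] at hlim
  refine hlim.trans ?_
  have hr1 : joukowskiRatio 1 = 0 := by simp [joukowskiRatio]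
  have hrw : joukowskiRatio w ≠ 0 :=
    div_ne_zero (pow_ne_zero _ (sub_ne_zero.2 fun h => hw (by simp [h]))) hw'
  have hval : Φ (fun j => if j.1 < 2 * m + 1 then 0 else joukowskiRatio w) =
      (Matrix.of fun i j : Fin m => (pencilPoly (joukowskiRatio w) i).coeff j).det := by
    have := (hΦ' (joukowskiRatio w)).trans (det_jetRow_stairRow m _)
    rw [mul_comm] at this
    exact mul_left_cancel₀ (pow_ne_zero _ hrw) this
  simp only [R, apply_ite joukowskiRatio, hr1]
  have hprod : ∏ j : Fin (2 * m + 1 + 1),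
      (1 - if j.1 < 2 * m + 1 then 0 else joukowskiRatio w) ^ m = (1 - joukowskiRatio w) ^ m := by
    rw [Fin.prod_univ_castSucc, Finset.prod_eq_one fun i _ => by
      simp only [Fin.val_castSucc, i.2, if_true, sub_zero, one_pow]]
    simp
  rw [hval, hprod, ← inv_pow_mul_det_pencilPoly m hw0 hw']

theorem IsSymplecticExt.apply_ones {m : ℕ} {X : (Fin (2 * (m + 1)) → ℂ) → ℂ}
    (hX : IsSymplecticExt (2 * (m + 1)) X) {w : ℂ} (hw : w ≠ 0) :
    X (fun i => if i.1 < 2 * m + 1 then 1 else w) =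
      3 ^ ((m + 1) * m) * stairDet m (joukowski w) := by
  have hdense :
      Dense ({z : ℂ | z.im ≠ 0} \ {z | (Polynomial.X ^ 2 + Polynomial.X + 1 : ℂ[X]).IsRoot z}) := by
    refine Dense.sdiff_finite ?_ (Polynomial.finite_setOfPred_isRoot ?_)
    · exact (dense_compl_singleton (0 : ℝ)).preimage Complex.isOpenMap_im
    · intro h
      have := congrArg (eval 0) h
      simp at this
  have hc1 : ContinuousAt (fun v : ℂ => X fun i => if i.1 < 2 * m + 1 then 1 else v) w := by
    refine ContinuousAt.comp (g := X) (hX.continuousAt fun j => ?_) (Continuous.continuousAt ?_)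
    · split_ifs
      · exact one_ne_zero
      · exact hw
    · refine continuous_pi fun j => ?_
      split_ifs <;> fun_prop
  have hc2 : ContinuousAt (fun v : ℂ => 3 ^ ((m + 1) * m) * stairDet m (joukowski v)) w := by
    refine continuousAt_const.mul ((continuous_stairDet m).continuousAt.comp ?_)
    unfold joukowski
    fun_prop (disch := assumption)
  refine tendsto_nhds_unique_of_frequently_eq hc1.tendsto hc2.tendsto
    ((mem_closure_iff_frequently.1 (hdense w)).mono fun v hv => ?_)
  exact hX.apply_ones_of_im_ne_zero hv.1 fun h => hv.2 (by simpa [IsRoot] using h)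

theorem joukowski_div_sq_mul {β q x : ℂ} (hβ : β ≠ 0) (hβ2 : β ^ 2 ≠ 1) (hq : q ^ 2 + q + 1 = 0)
    (hx : x = -((β * q - (β * q)⁻¹) / (β - β⁻¹))) :
    joukowski ((β / q) ^ 2) * (1 - x + x ^ 2) = -(x - 1) ^ 2 := by
  have hq0 : q ≠ 0 := by rintro rfl; simp at hq
  have hb : β ^ 2 - 1 ≠ 0 := sub_ne_zero.2 hβ2
  have hq3 : q ^ 3 = 1 := by linear_combination (q - 1) * hq
  have hxb : x * (β ^ 2 - 1) = q ^ 2 - β ^ 2 * q := by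
    rw [hx]
    have : β - β⁻¹ = (β ^ 2 - 1) / β := by field_simp
    rw [this]
    field_simp
    linear_combination -hq3
  have hw : (β / q) ^ 2 = β ^ 2 * q := by
    field_simp
    linear_combination -hq3
  have hw' : (β ^ 2 * q)⁻¹ = q ^ 2 / β ^ 2 := by
    field_simp
    linear_combination -hq3
  rw [hw, joukowski, hw']
  have key : ∀ y : ℂ, (y ^ 2 * q + q ^ 2 - 2 * y) *
      ((y - 1) ^ 2 - (q ^ 2 - y * q) * (y - 1) + (q ^ 2 - y * q) ^ 2) =
      -(3 * y * (q ^ 2 - y * q - (y - 1)) ^ 2) := fun y => by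
    linear_combination (q ^ 4 + y ^ 2 * q ^ 3 - 2 * y * q ^ 3 - q ^ 3 - 2 * y ^ 3 * q ^ 2 +
      2 * y * q ^ 2 + q ^ 2 + y ^ 3 * q + y ^ 4 * q - y * q - y ^ 2 * q - 2 * y ^ 2 + y ^ 3 + y) * hq
  have hD : (1 - x + x ^ 2) * (β ^ 2 - 1) ^ 2 = (β ^ 2 - 1) ^ 2 -
      (q ^ 2 - β ^ 2 * q) * (β ^ 2 - 1) + (q ^ 2 - β ^ 2 * q) ^ 2 := by
    rw [← hxb]; ring
  have hA : (x - 1) ^ 2 * (β ^ 2 - 1) ^ 2 = (q ^ 2 - β ^ 2 * q - (β ^ 2 - 1)) ^ 2 := by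
    rw [← hxb]; ring
  have hs : (β ^ 2 * q + q ^ 2 / β ^ 2 - 2) / 3 =
      ((β ^ 2) ^ 2 * q + q ^ 2 - 2 * β ^ 2) / (3 * β ^ 2) := by
    field_simp
  refine mul_right_cancel₀ (pow_ne_zero 2 hb) ?_
  rw [mul_assoc, hD, neg_mul, hA, hs, div_mul_eq_mul_div, key (β ^ 2)]
  field_simp

theorem stairDet_eq (m : ℕ) {s x : ℂ} (hx : 1 - x + x ^ 2 ≠ 0)
    (hs : s * (1 - x + x ^ 2) = -(x - 1) ^ 2) :
    stairDet m s = ((1 - x + x ^ 2) ^ m)⁻¹ * (Matrix.of fun i j : Fin m =>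
      (x - 1) ^ 2 * (zchoose ((i.1 : ℤ) + j.1 + 1) (2 * (j.1 : ℤ) - i.1 + 1) : ℂ) +
        x * (zchoose ((i.1 : ℤ) + j.1 + 3) (2 * (j.1 : ℤ) - i.1 + 2) : ℂ)).det := by
  have := Matrix.det_smul (Matrix.of fun i j : Fin m =>
    (x - 1) ^ 2 * (zchoose ((i.1 : ℤ) + j.1 + 1) (2 * (j.1 : ℤ) - i.1 + 1) : ℂ) +
      x * (zchoose ((i.1 : ℤ) + j.1 + 3) (2 * (j.1 : ℤ) - i.1 + 2) : ℂ)) (1 - x + x ^ 2)⁻¹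
  rw [Fintype.card_fin, inv_pow] at this
  rw [← this, stairDet]
  congr 1
  ext i j
  have e1 : s = (1 - x + x ^ 2)⁻¹ * -(x - 1) ^ 2 := by
    rw [← hs]; field_simp
  have e2 : 1 + s = (1 - x + x ^ 2)⁻¹ * x := by
    rw [eq_inv_mul_iff_mul_eq₀ hx]
    linear_combination hs
  rw [Matrix.smul_apply, Matrix.of_apply, Matrix.of_apply, smul_eq_mul, e2, e1]
  ring

end

/-- **Proposition 3.4.** Determinant formula for the even-size symplectic
character specialised at `(1, …, 1, (β/q)²)` with `q = e^{2πi/3}`. -/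
theorem sympl_char_det_even (n : ℕ) (hn : 1 ≤ n) (β : ℂ) (hβ : β ≠ 0) (hβ2 : β^2 ≠ 1)
    (q : ℂ) (hq : q = Complex.exp (2 * Real.pi * Complex.I / 3))
    (x : ℂ) (hx : x = -((β*q - (β*q)⁻¹) / (β - β⁻¹)))
    (hxx : 1 - x + x^2 ≠ 0)
    (X : (Fin (2*n) → ℂ) → ℂ) (hX : IsSymplecticExt (2*n) X) :
    X (fun i => if i.1 < 2*n - 1 then 1 else (β/q)^2)
      = 3^(n*(n-1)) / (1 - x + x^2)^(n-1) *
        Matrix.det (Matrix.of fun i j : Fin (n-1) =>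
          (x-1)^2 * (zchoose ((i.1 : ℤ) + j.1 + 1) (2*(j.1 : ℤ) - i.1 + 1) : ℂ)
          + x * (zchoose ((i.1 : ℤ) + j.1 + 3) (2*(j.1 : ℤ) - i.1 + 2) : ℂ)) := by
  obtain ⟨m, rfl⟩ := Nat.exists_eq_add_of_le' hn
  have hprim : IsPrimitiveRoot q 3 := by
    rw [hq]
    exact_mod_cast Complex.isPrimitiveRoot_exp 3 three_ne_zero
  have hq0 : q ≠ 0 := hprim.ne_zero three_ne_zero
  have hq2 : q ^ 2 + q + 1 = 0 := by
    have h1 : q - 1 ≠ 0 := sub_ne_zero.2 (hprim.ne_one (by norm_num))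
    refine mul_left_cancel₀ h1 ?_
    linear_combination hprim.pow_eq_one
  have h := hX.apply_ones (pow_ne_zero 2 (div_ne_zero hβ hq0))
  rw [stairDet_eq m hxx (joukowski_div_sq_mul hβ hβ2 hq2 hx)] at h
  rw [Nat.add_sub_cancel]
  refine h.trans ?_
  ring

end
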